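/- For every integer n ≥ 3, f_{231}(S_n(123,132,213)) = f_{312}(S_n(123,132,213)), and the formal power series F(x) = ∑_{n≥0} f_{231}(S_n(123,132,213)) x^n (whose coefficients vanish for n < 3) satisfies the identity (1 − x − x²)³ · F(x) = x³(1 + 2x) in ℤ⟦x⟧. -/

import Mathlib

open Finset

/-- Number of occurrences of the length-3 pattern `q` (given by its sequence of values)
in the permutation `σ` of `Fin n`: triples of indices `ι 0 < ι 1 < ι 2` whose values under
`σ` are in the same relative order as the values of `q`. -/
def occ (n : ℕ) (q : Fin 3 → ℕ) (σ : Equiv.Perm (Fin n)) : ℕ :=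
  (Finset.univ.filter fun ι : Fin 3 → Fin n =>
    (∀ j l : Fin 3, j < l → ι j < ι l) ∧
    (∀ j l : Fin 3, q j < q l ↔ σ (ι j) < σ (ι l))).card

/-- The set `S_n(R)` of permutations of `{1,…,n}` avoiding every pattern in `R`. -/
def avoiders (n : ℕ) (R : List (Fin 3 → ℕ)) : Finset (Equiv.Perm (Fin n)) :=
  Finset.univ.filter fun σ => ∀ q ∈ R, occ n q σ = 0

/-- `f_q(S_n(R))`: the total number of occurrences of the pattern `q` among
all permutations in `S_n(R)`. -/
def fCnt (n : ℕ) (q : Fin 3 → ℕ) (R : List (Fin 3 → ℕ)) : ℕ :=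
  ∑ σ ∈ avoiders n R, occ n q σ

def p123 : Fin 3 → ℕ := ![1, 2, 3]
def p132 : Fin 3 → ℕ := ![1, 3, 2]
def p213 : Fin 3 → ℕ := ![2, 1, 3]
def p231 : Fin 3 → ℕ := ![2, 3, 1]
def p312 : Fin 3 → ℕ := ![3, 1, 2]
def p321 : Fin 3 → ℕ := ![3, 2, 1]

/-- Permutations all of whose entries at distance at least two are inverted. -/
def DistInverting {n : ℕ} (σ : Equiv.Perm (Fin n)) : Prop :=
  ∀ i k : Fin n, i.val + 2 ≤ k.val → σ k < σ i

/-- Sum over the ascents `(i, i + 1)` of `σ` of the number of positions after `i + 1`. -/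
def ascentWeight {n : ℕ} (σ : Equiv.Perm (Fin n)) : ℕ :=
  ∑ i : Fin n, if ∃ j : Fin n, j.val = i.val + 1 ∧ σ i < σ j then n - (i.val + 2) else 0

/-- Put a new maximal value in front of a permutation. -/
def consMax {n : ℕ} (σ : Equiv.Perm (Fin n)) : Equiv.Perm (Fin (n + 1)) :=
  (finSuccEquiv n).trans ((Equiv.optionCongr σ).trans finSuccEquivLast.symm)

/-- Put two new maximal values, in increasing order, in front of a permutation. -/
def consAscent {n : ℕ} (σ : Equiv.Perm (Fin n)) : Equiv.Perm (Fin (n + 2)) :=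
  consMax (consMax σ) * Equiv.swap 0 1

@[simp] lemma consMax_zero {n : ℕ} (σ : Equiv.Perm (Fin n)) : consMax σ 0 = Fin.last n := by
  simp [consMax]

@[simp] lemma consMax_succ {n : ℕ} (σ : Equiv.Perm (Fin n)) (i : Fin n) :
    consMax σ i.succ = (σ i).castSucc := by
  simp [consMax]

lemma consMax_injective {n : ℕ} :
    Function.Injective (consMax : Equiv.Perm (Fin n) → Equiv.Perm (Fin (n + 1))) := by
  intro σ τ h
  ext i
  have := DFunLike.congr_fun h i.succ
  simpa [Fin.ext_iff] using this

lemma exists_consMax_eq {n : ℕ} (τ : Equiv.Perm (Fin (n + 1))) (h : τ 0 = Fin.last n) :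
    ∃ σ, consMax σ = τ := by
  have hne (i : Fin n) : τ i.succ ≠ Fin.last n := by
    rw [← h]
    exact fun e => Fin.succ_ne_zero i (τ.injective e)
  let f : Fin n → Fin n := fun i => (τ i.succ).castPred (hne i)
  have hf : Function.Injective f := by
    intro i j hij
    simpa [f, Fin.castPred_inj] using hij
  refine ⟨Equiv.ofBijective f (Finite.injective_iff_bijective.mp hf), ?_⟩
  ext i
  refine Fin.cases ?_ (fun i => ?_) i
  · simp [h]
  · simp [f]

@[simp] lemma consAscent_zero {n : ℕ} (σ : Equiv.Perm (Fin n)) :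
    consAscent σ 0 = (Fin.last n).castSucc := by
  rw [consAscent, Equiv.Perm.mul_apply, Equiv.swap_apply_left, ← Fin.succ_zero_eq_one,
    consMax_succ, consMax_zero]

@[simp] lemma consAscent_one {n : ℕ} (σ : Equiv.Perm (Fin n)) :
    consAscent σ 1 = Fin.last (n + 1) := by
  rw [consAscent, Equiv.Perm.mul_apply, Equiv.swap_apply_right, consMax_zero]

@[simp] lemma consAscent_succ_succ {n : ℕ} (σ : Equiv.Perm (Fin n)) (i : Fin n) :
    consAscent σ i.succ.succ = (σ i).castSucc.castSucc := by
  rw [consAscent, Equiv.Perm.mul_apply, Equiv.swap_apply_of_ne_of_ne, consMax_succ, consMax_succ]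
  · exact Fin.succ_ne_zero _
  · simp [Fin.ext_iff]

lemma consAscent_injective {n : ℕ} :
    Function.Injective (consAscent : Equiv.Perm (Fin n) → Equiv.Perm (Fin (n + 2))) :=
  fun _ _ h => consMax_injective (consMax_injective (mul_right_cancel h))

lemma distInverting_consMax {n : ℕ} (σ : Equiv.Perm (Fin n)) :
    DistInverting (consMax σ) ↔ DistInverting σ := by
  constructor
  · intro h i k hik
    have := h i.succ k.succ (by simp; omega)
    simpa using this
  · intro h i k hik
    induction k using Fin.cases with
    | zero => simp at hik
    | succ k =>
      induction i using Fin.cases with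
      | zero => simp [Fin.castSucc_lt_last]
      | succ i =>
        have := h i k (by simp at hik; omega)
        simpa using this

lemma distInverting_consAscent {n : ℕ} (σ : Equiv.Perm (Fin n)) :
    DistInverting (consAscent σ) ↔ DistInverting σ := by
  constructor
  · intro h i k hik
    have := h i.succ.succ k.succ.succ (by simp; omega)
    simpa using this
  · intro h i k hik
    induction k using Fin.cases with
    | zero => simp at hik
    | succ k =>
      induction k using Fin.cases with
      | zero => simp at hik
      | succ k =>
        induction i using Fin.cases with
        | zero => simp [Fin.castSucc_lt_last]
        | succ i =>
          induction i using Fin.cases with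
          | zero => simp [Fin.castSucc_lt_last]
          | succ i =>
            have := h i k (by simp at hik; omega)
            simpa using this

lemma exists_of_distInverting {n : ℕ} (τ : Equiv.Perm (Fin (n + 2))) (h : DistInverting τ) :
    (∃ σ, consMax σ = τ) ∨ ∃ σ, consAscent σ = τ := by
  by_cases h0 : τ 0 = Fin.last (n + 1)
  · exact Or.inl (exists_consMax_eq τ h0)
  right
  obtain ⟨p, hp⟩ := τ.surjective (Fin.last (n + 1))
  have hp1 : p = 1 := by
    by_contra hne
    have hp0 : p ≠ 0 := by rintro rfl; exact h0 hp
    have := h 0 p (by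
      rw [ne_eq, Fin.ext_iff, Fin.val_zero] at hp0
      rw [Fin.ext_iff, Fin.val_one] at hne
      rw [Fin.val_zero]
      omega)
    rw [hp] at this
    exact absurd this (Fin.le_last _).not_gt
  subst hp1
  obtain ⟨ρ, hρ⟩ := exists_consMax_eq (τ * Equiv.swap 0 1) (by simpa using hp)
  have hτ : τ = consMax ρ * Equiv.swap 0 1 := by
    rw [hρ, mul_assoc, Equiv.swap_mul_self, mul_one]
  have hρ0 : ρ 0 = Fin.last n := by
    obtain ⟨k, hk⟩ := ρ.surjective (Fin.last n)
    induction k using Fin.cases with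
    | zero => exact hk
    | succ k =>
      have := h 0 k.succ.succ (by simp)
      rw [hτ, Equiv.Perm.mul_apply, Equiv.Perm.mul_apply, Equiv.swap_apply_left,
        Equiv.swap_apply_of_ne_of_ne (Fin.succ_ne_zero _) (by simp [Fin.ext_iff]),
        ← Fin.succ_zero_eq_one, consMax_succ, consMax_succ, hk, Fin.castSucc_lt_castSucc_iff] at this
      exact absurd this (Fin.le_last _).not_gt
  obtain ⟨σ, rfl⟩ := exists_consMax_eq ρ hρ0
  exact ⟨σ, hτ.symm⟩

lemma ascentWeight_consMax {n : ℕ} (σ : Equiv.Perm (Fin n)) :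
    ascentWeight (consMax σ) = ascentWeight σ := by
  rw [ascentWeight, Fin.sum_univ_succ, if_neg, zero_add, ascentWeight]
  · refine Finset.sum_congr rfl fun i _ => ?_
    congr 1
    · simp [Fin.exists_fin_succ]
    · simp
  · rintro ⟨j, -, hj⟩
    rw [consMax_zero] at hj
    exact absurd hj (Fin.le_last _).not_gt

lemma ascentWeight_consAscent {n : ℕ} (σ : Equiv.Perm (Fin n)) :
    ascentWeight (consAscent σ) = n + ascentWeight σ := by
  rw [ascentWeight, Fin.sum_univ_succ, if_pos, Fin.sum_univ_succ, if_neg, zero_add, ascentWeight]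
  · congr 1
    refine Finset.sum_congr rfl fun i _ => ?_
    congr 1
    · simp [Fin.exists_fin_succ]
    · simp
  · rintro ⟨j, -, hj⟩
    rw [Fin.succ_zero_eq_one, consAscent_one] at hj
    exact absurd hj (Fin.le_last _).not_gt
  · exact ⟨1, by simp, by simp [Fin.castSucc_lt_last]⟩

lemma occ_eq_zero_iff {n : ℕ} (q : Fin 3 → ℕ) (σ : Equiv.Perm (Fin n)) :
    occ n q σ = 0 ↔ ∀ i j k : Fin n, i < j → j < k →
      ¬ ∀ a b : Fin 3, q a < q b ↔ σ (![i, j, k] a) < σ (![i, j, k] b) := by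
  rw [occ, Finset.card_eq_zero, Finset.filter_eq_empty_iff]
  constructor
  · intro h i j k hij hjk hq
    refine h (Finset.mem_univ ![i, j, k]) ⟨?_, hq⟩
    simp [Fin.forall_fin_succ, hij, hjk, hij.trans hjk]
  · rintro h ι - ⟨h1, h2⟩
    have hι : ι = ![ι 0, ι 1, ι 2] := by
      ext a; fin_cases a <;> rfl
    refine h (ι 0) (ι 1) (ι 2) (h1 _ _ (by decide)) (h1 _ _ (by decide)) ?_
    rwa [← hι]

lemma mem_avoiders_iff {n : ℕ} (σ : Equiv.Perm (Fin n)) :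
    σ ∈ avoiders n [p123, p132, p213] ↔ DistInverting σ := by
  simp only [avoiders, Finset.mem_filter, Finset.mem_univ, true_and, List.mem_cons,
    List.not_mem_nil, or_false, forall_eq_or_imp, forall_eq, occ_eq_zero_iff]
  constructor
  · rintro ⟨h1, h2, h3⟩ i k hik
    let j : Fin n := ⟨i.val + 1, by omega⟩
    have hij : i < j := Fin.lt_def.mpr (by simp [j])
    have hjk : j < k := Fin.lt_def.mpr (by simp [j]; omega)
    have n1 : (σ i).val ≠ (σ j).val := fun e => hij.ne (σ.injective (Fin.ext e))
    have n2 : (σ j).val ≠ (σ k).val := fun e => hjk.ne (σ.injective (Fin.ext e))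
    have n3 : (σ i).val ≠ (σ k).val := fun e => (hij.trans hjk).ne (σ.injective (Fin.ext e))
    have h1 := h1 i j k hij hjk
    have h2 := h2 i j k hij hjk
    have h3 := h3 i j k hij hjk
    simp [Fin.forall_fin_succ, p123, p132, p213, Fin.lt_def, -Fin.val_fin_lt] at h1 h2 h3
    rw [Fin.lt_def]
    omega
  · intro h
    refine ⟨?_, ?_, ?_⟩ <;>
    · intro i j k hij hjk hq
      have := h i k (by rw [Fin.lt_def] at hij hjk; omega)
      simp [Fin.forall_fin_succ, p123, p132, p213, Fin.lt_def, -Fin.val_fin_lt] at hq this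
      omega

lemma sum_avoiders_add_two {n : ℕ} (f : Equiv.Perm (Fin (n + 2)) → ℕ) :
    ∑ τ ∈ avoiders (n + 2) [p123, p132, p213], f τ =
      ∑ σ ∈ avoiders (n + 1) [p123, p132, p213], f (consMax σ) +
        ∑ σ ∈ avoiders n [p123, p132, p213], f (consAscent σ) := by
  have hA : avoiders (n + 2) [p123, p132, p213] =
      (avoiders (n + 1) [p123, p132, p213]).image consMax ∪
        (avoiders n [p123, p132, p213]).image consAscent := by
    ext τ
    simp only [Finset.mem_union, Finset.mem_image, mem_avoiders_iff]
    constructor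
    · intro h
      rcases exists_of_distInverting τ h with ⟨σ, rfl⟩ | ⟨σ, rfl⟩
      · exact Or.inl ⟨σ, (distInverting_consMax σ).mp h, rfl⟩
      · exact Or.inr ⟨σ, (distInverting_consAscent σ).mp h, rfl⟩
    · rintro (⟨σ, h, rfl⟩ | ⟨σ, h, rfl⟩)
      · exact (distInverting_consMax σ).mpr h
      · exact (distInverting_consAscent σ).mpr h
  rw [hA, Finset.sum_union, Finset.sum_image consMax_injective.injOn,
    Finset.sum_image consAscent_injective.injOn]
  rw [Finset.disjoint_left]
  simp only [Finset.mem_image, not_exists, not_and]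
  rintro _ ⟨σ, -, rfl⟩ ρ - h
  have := DFunLike.congr_fun h 0
  simp [Fin.ext_iff] at this

lemma occ_p231_eq_ascentWeight {n : ℕ} (σ : Equiv.Perm (Fin n)) (h : DistInverting σ) :
    occ n p231 σ = ascentWeight σ := by
  rw [occ, Finset.card_eq_sum_card_fiberwise (f := fun ι => ι 0) (t := Finset.univ)
    (fun _ _ => Finset.mem_coe.mpr (Finset.mem_univ _)), ascentWeight]
  refine Finset.sum_congr rfl fun i _ => ?_
  have key (ι : Fin 3 → Fin n) : ((∀ j l : Fin 3, j < l → ι j < ι l) ∧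
      (∀ j l : Fin 3, p231 j < p231 l ↔ σ (ι j) < σ (ι l))) ↔
      (ι 1).val = (ι 0).val + 1 ∧ (ι 0).val + 2 ≤ (ι 2).val ∧ σ (ι 0) < σ (ι 1) := by
    constructor
    · rintro ⟨h1, h2⟩
      have h01 := h1 0 1 (by decide)
      have h12 := h1 1 2 (by decide)
      have hs := (h2 0 1).mp (by decide)
      have := h (ι 0) (ι 1)
      simp only [Fin.lt_def] at *
      omega
    · rintro ⟨h1, h2, h3⟩
      have h20 := h _ _ h2
      simp [Fin.forall_fin_succ, p231, Fin.lt_def, -Fin.val_fin_lt] at *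
      omega
  simp only [key, Finset.filter_filter]
  split_ifs with hi
  · obtain ⟨j, hj, hs⟩ := hi
    have : n - (i.val + 2) = (Finset.Ioi j).card := by simp; omega
    rw [this]
    refine Finset.card_nbij' (fun ι => ι 2) (fun k => ![i, j, k]) ?_ ?_ ?_ ?_
    · intro ι hι
      simp only [Finset.coe_filter, Finset.mem_univ, true_and, Set.mem_ofPred_eq] at hι
      obtain ⟨⟨_, h2, _⟩, rfl⟩ := hι
      simp [Fin.lt_def, -Fin.val_fin_lt]
      omega
    · intro k hk
      simp [Fin.lt_def, -Fin.val_fin_lt] at hk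
      simp [hj, hs]
      omega
    · intro ι hι
      simp only [Finset.coe_filter, Finset.mem_univ, true_and, Set.mem_ofPred_eq] at hι
      obtain ⟨⟨h1, h2, _⟩, rfl⟩ := hι
      have : ι 1 = j := Fin.ext (by omega)
      ext a
      fin_cases a <;> simp [this]
    · intro k _
      simp
  · rw [Finset.card_eq_zero, Finset.filter_eq_empty_iff]
    rintro ι - ⟨⟨h1, _, h3⟩, rfl⟩
    exact hi ⟨ι 1, h1, h3⟩

lemma fCnt_eq_sum_ascentWeight (n : ℕ) :
    fCnt n p231 [p123, p132, p213] =
      ∑ σ ∈ avoiders n [p123, p132, p213], ascentWeight σ :=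
  Finset.sum_congr rfl fun σ hσ => occ_p231_eq_ascentWeight σ ((mem_avoiders_iff σ).mp hσ)

lemma fCnt_add_two (n : ℕ) :
    fCnt (n + 2) p231 [p123, p132, p213] = fCnt (n + 1) p231 [p123, p132, p213] +
      (fCnt n p231 [p123, p132, p213] + n * (avoiders n [p123, p132, p213]).card) := by
  simp only [fCnt_eq_sum_ascentWeight, sum_avoiders_add_two, ascentWeight_consMax,
    ascentWeight_consAscent, Finset.sum_add_distrib, Finset.sum_const, smul_eq_mul]
  ring

lemma card_avoiders_add_two (n : ℕ) :
    (avoiders (n + 2) [p123, p132, p213]).card =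
      (avoiders (n + 1) [p123, p132, p213]).card + (avoiders n [p123, p132, p213]).card := by
  simp only [Finset.card_eq_sum_ones, sum_avoiders_add_two]

lemma card_avoiders_of_le_one {n : ℕ} (hn : n ≤ 1) :
    (avoiders n [p123, p132, p213]).card = 1 := by
  have : avoiders n [p123, p132, p213] = Finset.univ :=
    Finset.eq_univ_of_forall fun σ => (mem_avoiders_iff σ).mpr fun i k h => by omega
  rw [this, Finset.card_univ, Fintype.card_perm, Fintype.card_fin]
  interval_cases n <;> rfl

lemma fCnt_of_le_one {n : ℕ} (hn : n ≤ 1) : fCnt n p231 [p123, p132, p213] = 0 := by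
  rw [fCnt_eq_sum_ascentWeight]
  refine Finset.sum_eq_zero fun σ _ => Finset.sum_eq_zero fun i _ => ?_
  rw [if_neg]
  rintro ⟨j, hj, -⟩
  omega

/-- The reverse-complement of a permutation. -/
def reverseComplement (n : ℕ) : Equiv.Perm (Fin n) ≃ Equiv.Perm (Fin n) :=
  Equiv.permCongr Fin.revPerm

lemma distInverting_reverseComplement {n : ℕ} {σ : Equiv.Perm (Fin n)} (h : DistInverting σ) :
    DistInverting (reverseComplement n σ) := by
  intro i k hik
  have := h k.rev i.rev (by simp [Fin.val_rev]; omega)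
  simpa [reverseComplement, Equiv.permCongr_apply, Fin.rev_lt_rev] using this

lemma occ_p312_reverseComplement {n : ℕ} (σ : Equiv.Perm (Fin n)) :
    occ n p312 (reverseComplement n σ) = occ n p231 σ := by
  refine Finset.card_nbij' (fun ι a => (ι a.rev).rev) (fun ι a => (ι a.rev).rev) ?_ ?_ ?_ ?_
  · rintro ι hι
    simp [Fin.forall_fin_succ, p231, p312, reverseComplement,
      Fin.rev_lt_rev, Fin.rev_eq] at hι ⊢
    tauto
  · rintro ι hι
    simp [Fin.forall_fin_succ, p231, p312, reverseComplement,
      Fin.rev_lt_rev, Fin.rev_eq] at hι ⊢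
    tauto
  · intro ι _
    simp
  · intro ι _
    simp

lemma fCnt_p231_eq_fCnt_p312 (n : ℕ) :
    fCnt n p231 [p123, p132, p213] = fCnt n p312 [p123, p132, p213] := by
  refine Finset.sum_equiv (reverseComplement n) (fun σ => ?_)
    fun σ _ => (occ_p312_reverseComplement σ).symm
  rw [mem_avoiders_iff, mem_avoiders_iff]
  refine ⟨distInverting_reverseComplement, fun h => ?_⟩
  have := distInverting_reverseComplement h
  convert this using 1
  ext i
  simp [reverseComplement]

open PowerSeries in
lemma pow_three_mul_eq_of_recurrence (a c : ℕ → ℤ) (ha0 : a 0 = 0) (ha1 : a 1 = 0)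
    (ha : ∀ n, a (n + 2) = a (n + 1) + (a n + n * c n)) (hc0 : c 0 = 1) (hc1 : c 1 = 1)
    (hc : ∀ n, c (n + 2) = c (n + 1) + c n) :
    ((1 : PowerSeries ℤ) - X - X ^ 2) ^ 3 * PowerSeries.mk a = X ^ 3 * (1 + 2 * X) := by
  have coeff_mul (u : ℕ → ℤ) (n : ℕ) : coeff (n + 2) ((1 - X - X ^ 2) * PowerSeries.mk u) =
      u (n + 2) - u (n + 1) - u n := by
    rw [sub_mul, sub_mul, one_mul, map_sub, map_sub, coeff_succ_X_mul, coeff_X_pow_mul]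
    simp
  have coeff_mul_zero (u : ℕ → ℤ) : coeff 0 ((1 - X - X ^ 2) * PowerSeries.mk u) = u 0 := by
    simp
  have coeff_mul_one (u : ℕ → ℤ) : coeff 1 ((1 - X - X ^ 2) * PowerSeries.mk u) = u 1 - u 0 := by
    rw [sub_mul, sub_mul, one_mul, map_sub, map_sub, coeff_succ_X_mul, coeff_X_pow_mul']
    simp
  have hC : (1 - X - X ^ 2) * PowerSeries.mk c = 1 := by
    ext n
    match n with
    | 0 => rw [coeff_mul_zero, hc0]; simp
    | 1 => rw [coeff_mul_one, hc0, hc1]; simp [coeff_one]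
    | n + 2 => rw [coeff_mul, hc]; simp [coeff_one]
  have hA : (1 - X - X ^ 2) * PowerSeries.mk a = X ^ 3 * derivative ℤ (PowerSeries.mk c) := by
    ext n
    match n with
    | 0 => rw [coeff_mul_zero, ha0, coeff_X_pow_mul']; simp
    | 1 => rw [coeff_mul_one, ha0, ha1, coeff_X_pow_mul']; simp
    | 2 => rw [coeff_mul, ha, coeff_X_pow_mul']; simp
    | n + 3 => rw [coeff_mul, ha, coeff_X_pow_mul, coeff_derivative, coeff_mk]; push_cast; ring
  have hD := congrArg (derivative ℤ) hC
  simp only [Derivation.leibniz, map_sub, Derivation.map_one_eq_zero, Derivation.leibniz_pow,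
    derivative_X, smul_eq_mul, nsmul_eq_mul] at hD
  push_cast at hD
  linear_combination (1 - X - X ^ 2) ^ 2 * hA + X ^ 3 * (1 - X - X ^ 2) * hD
    + X ^ 3 * (1 + 2 * X) * hC

/-- First part of Theorem `Tta1`: `f_{231}(S_n(123,132,213)) = f_{312}(S_n(123,132,213))`
for `n ≥ 3`, and the generating function `∑_n f_{231}(S_n(123,132,213)) xⁿ` equals
`x³(1+2x)/(1−x−x²)³`, i.e. `(1−x−x²)³·F(x) = x³(1+2x)` in `ℤ⟦x⟧`. -/
theorem stmt_12 :
    (∀ n : ℕ, 3 ≤ n → fCnt n p231 [p123, p132, p213] = fCnt n p312 [p123, p132, p213]) ∧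
    ((1 : PowerSeries ℤ) - PowerSeries.X - PowerSeries.X ^ 2) ^ 3 *
        PowerSeries.mk (fun n => (fCnt n p231 [p123, p132, p213] : ℤ)) =
      PowerSeries.X ^ 3 * (1 + 2 * PowerSeries.X) := by
  refine ⟨fun n _ => fCnt_p231_eq_fCnt_p312 n, ?_⟩
  refine pow_three_mul_eq_of_recurrence _
    (fun n => ((avoiders n [p123, p132, p213]).card : ℤ)) ?_ ?_ ?_ ?_ ?_ ?_
  · exact_mod_cast fCnt_of_le_one zero_le_one
  · exact_mod_cast fCnt_of_le_one le_rfl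
  · exact fun n => by exact_mod_cast fCnt_add_two n
  · exact_mod_cast card_avoiders_of_le_one zero_le_one
  · exact_mod_cast card_avoiders_of_le_one le_rfl
  · exact fun n => by exact_mod_cast card_avoiders_add_two n
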